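/- Suppose the pair (C,p) is welfare-optimal, i.e., W(M(C,p)) ≥ W(M(C',p')) for every integer cap C' ≥ 1 and every price floor p' ≥ 0. Then there exists an integer C'' ≥ 1 such that 26·W(M(C'')) + W^{(1)} ≥ W(M(C,p)); consequently, for every cap C''' ≥ 1 and price floor p''' ≥ 0 one has 26·W(M(C'')) + W^{(1)} ≥ W(M(C''',p''')). -/

import Mathlib

open MeasureTheory ProbabilityTheory

noncomputable section

/-- The marginal value of the `j`-th license under the curve `V`. -/
def marg (V : ℕ → ℝ) (j : ℕ) : ℝ := V j - V (j - 1)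

/-- A valuation curve: `V 0 = 0`, nondecreasing, nonincreasing marginal values,
and only finitely many nonzero marginal values. -/
def IsValuation (V : ℕ → ℝ) : Prop :=
  V 0 = 0 ∧ Monotone V ∧ (∀ j : ℕ, 1 ≤ j → marg V (j + 1) ≤ marg V j) ∧
    ∃ N : ℕ, ∀ j : ℕ, N ≤ j → marg V j = 0

/-- A social cost function: `Q 0 = 0`, nondecreasing, and (discretely) convex. -/
def IsCost (Q : ℕ → ℝ) : Prop :=
  Q 0 = 0 ∧ Monotone Q ∧ ∀ x : ℕ, 1 ≤ x → Q x - Q (x - 1) ≤ Q (x + 1) - Q x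

/-- The demand of a valuation curve at price `p`:
`sup { j ≥ 1 : marg V j ≥ p } ∈ ℕ ∪ {∞}` (with `sup ∅ = 0`). -/
def dem (V : ℕ → ℝ) (p : ℝ) : ℕ∞ :=
  sSup {j : ℕ∞ | ∃ k : ℕ, j = (k : ℕ∞) ∧ 1 ≤ k ∧ p ≤ marg V k}

/-- Number of licenses sold to curve `V` under cap `C` (possibly `∞`) and price floor `p`. -/
def sold (C : ℕ∞) (p : ℝ) (V : ℕ → ℝ) : ℕ := (min C (dem V p)).toNat

/-- The safe price for cap `C`: the average social cost `Q C / C` per license. -/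
def safeP (Q : ℕ → ℝ) (C : ℕ) : ℝ := Q C / C

/-- Truth-telling expected welfare of the no-ceiling cap-and-price auction `M(C,p)`
for a distribution `F` over (combined) valuation curves. -/
def Wfl (F : Measure (ℕ → ℝ)) (Q : ℕ → ℝ) (C : ℕ∞) (p : ℝ) : ℝ :=
  ∫ V, (V (sold C p V) - Q (sold C p V)) ∂F

/-- Number of licenses sold under cap `C`, price floor `p`, and price ceiling `pbar`. -/
def xceil (C : ℕ) (p pbar : ℝ) (V : ℕ → ℝ) : ℕ :=
  if (C : ℕ∞) ≤ dem V pbar then (dem V pbar).toNat else sold (C : ℕ∞) p V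

/-- Truth-telling expected welfare of the cap-and-price auction `M(C,p,pbar)`. -/
def Wceil (F : Measure (ℕ → ℝ)) (Q : ℕ → ℝ) (C : ℕ) (p pbar : ℝ) : ℝ :=
  ∫ V, (V (xceil C p pbar V) - Q (xceil C p pbar V)) ∂F

/-- The combined valuation curve of a profile of valuation curves. -/
def comb {n : ℕ} (Vp : Fin n → ℕ → ℝ) (x : ℕ) : ℝ :=
  sSup {s : ℝ | ∃ y : Fin n → ℕ, (∑ i, y i) = x ∧ s = ∑ i, Vp i (y i)}

open Classical in
/-- Product of a family of probability measures (0 if the family fails to consist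
of probability measures). -/
def piProb {ι : Type*} [Fintype ι] {α : ι → Type*} [∀ i, MeasurableSpace (α i)]
    (μ : ∀ i, Measure (α i)) : Measure (∀ i, α i) :=
  if h : ∀ i, IsProbabilityMeasure (μ i) then
    haveI := h
    Measure.pi μ
  else 0

/-- Truth-telling expected welfare of `M(C,p)` for independent firms with
valuation distributions `F i`, computed via the combined valuation curve. -/
def Wcomb {n : ℕ} (F : Fin n → Measure (ℕ → ℝ)) (Q : ℕ → ℝ) (C : ℕ∞) (p : ℝ) : ℝ :=
  ∫ Vp, (comb Vp (sold C p (comb Vp)) - Q (sold C p (comb Vp))) ∂(piProb F)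

/-- Truth-telling expected welfare of `M(C,p,pbar)` for independent firms. -/
def WceilComb {n : ℕ} (F : Fin n → Measure (ℕ → ℝ)) (Q : ℕ → ℝ) (C : ℕ) (p pbar : ℝ) : ℝ :=
  ∫ Vp, (comb Vp (xceil C p pbar (comb Vp)) - Q (xceil C p pbar (comb Vp))) ∂(piProb F)

/-- `W^{(1)}`: the expected optimal welfare from allocating licenses to a single firm. -/
def W1 {n : ℕ} (F : Fin n → Measure (ℕ → ℝ)) (Q : ℕ → ℝ) : ℝ :=
  ∫ Vp, sSup {w : ℝ | ∃ (i : Fin n) (x : ℕ), w = Vp i x - Q x} ∂(piProb F)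

/-- The per-license price in the uniform-price auction with cap `C` and floor `pf`,
given a bid profile `b`. -/
def priceOf {n : ℕ} (C : ℕ) (pf : ℝ) (b : Fin n → ℕ → ℝ) : ℝ :=
  if (∑ i, dem (b i) pf) < (C : ℕ∞) then pf else comb b C - comb b (C - 1)

/-- A (measurable) tie-breaking allocation rule for the uniform-price auction with
cap `C` and price floor `pf`. -/
def IsAllocRule {n : ℕ} (C : ℕ) (pf : ℝ) (alloc : (Fin n → ℕ → ℝ) → Fin n → ℕ) : Prop :=
  Measurable alloc ∧
    ∀ b : Fin n → ℕ → ℝ, (∀ i, IsValuation (b i)) →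
      (((∑ i, dem (b i) pf) < (C : ℕ∞)) → ∀ i, alloc b i = (dem (b i) pf).toNat) ∧
      (((C : ℕ∞) ≤ ∑ i, dem (b i) pf) →
        (∑ i, alloc b i) = C ∧
          ∀ y : Fin n → ℕ, (∑ i, y i) = C → (∑ i, b i (y i)) ≤ ∑ i, b i (alloc b i))

/-- The strategy `σi` never overbids: with probability one the bid is a valuation
curve pointwise below the true valuation. -/
def NoOverbid (σi : Kernel (ℕ → ℝ) (ℕ → ℝ)) : Prop :=
  ∀ V : ℕ → ℝ, IsValuation V → σi V {B | IsValuation B ∧ ∀ x, B x ≤ V x} = 1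

/-- Expected welfare when the firms play the (randomized) strategy profile `σ`. -/
def EqWelfare {n : ℕ} (F : Fin n → Measure (ℕ → ℝ)) (σ : Fin n → Kernel (ℕ → ℝ) (ℕ → ℝ))
    (alloc : (Fin n → ℕ → ℝ) → Fin n → ℕ) (Q : ℕ → ℝ) : ℝ :=
  ∫ Vp, (∫ b, ((∑ i, Vp i (alloc b i)) - Q (∑ i, alloc b i))
      ∂(piProb fun j => σ j (Vp j))) ∂(piProb F)

/-- Expected utility of firm `i` with valuation `Vi` when every firm plays `σ`. -/
def EUeq {n : ℕ} (F : Fin n → Measure (ℕ → ℝ)) (σ : Fin n → Kernel (ℕ → ℝ) (ℕ → ℝ))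
    (alloc : (Fin n → ℕ → ℝ) → Fin n → ℕ) (C : ℕ) (pf : ℝ) (i : Fin n) (Vi : ℕ → ℝ) : ℝ :=
  ∫ Vp, (∫ b, (Vi (alloc b i) - priceOf C pf b * (alloc b i : ℝ))
      ∂(piProb fun j => σ j (Function.update Vp i Vi j))) ∂(piProb F)

/-- Expected utility of firm `i` with valuation `Vi` deviating to the fixed bid `Bt`
while the others play `σ`. -/
def EUdev {n : ℕ} (F : Fin n → Measure (ℕ → ℝ)) (σ : Fin n → Kernel (ℕ → ℝ) (ℕ → ℝ))
    (alloc : (Fin n → ℕ → ℝ) → Fin n → ℕ) (C : ℕ) (pf : ℝ) (i : Fin n) (Vi Bt : ℕ → ℝ) : ℝ :=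
  ∫ Vp, (∫ b, (Vi (alloc b i) - priceOf C pf b * (alloc b i : ℝ))
      ∂(piProb fun j => if j = i then Measure.dirac Bt else σ j (Vp j))) ∂(piProb F)

/-- Bayes–Nash equilibrium of the uniform-price auction with cap `C` and floor `pf`. -/
def IsBNE {n : ℕ} (F : Fin n → Measure (ℕ → ℝ)) (σ : Fin n → Kernel (ℕ → ℝ) (ℕ → ℝ))
    (alloc : (Fin n → ℕ → ℝ) → Fin n → ℕ) (C : ℕ) (pf : ℝ) : Prop :=
  ∀ (i : Fin n) (Vi : ℕ → ℝ), IsValuation Vi → ∀ Bt : ℕ → ℝ, IsValuation Bt →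
    EUdev F σ alloc C pf i Vi Bt ≤ EUeq F σ alloc C pf i Vi

/-- `θ_V = min( d_V(p), d_V(P(C)) )`, as a natural number. -/
def thetaN (Q : ℕ → ℝ) (C : ℕ) (p : ℝ) (V : ℕ → ℝ) : ℕ :=
  (min (dem V p) (dem V (safeP Q C))).toNat

namespace IsValuation

variable {V : ℕ → ℝ}

lemma nonneg (h : IsValuation V) (x : ℕ) : 0 ≤ V x := h.1 ▸ h.2.1 (Nat.zero_le x)

lemma marg_le_marg (h : IsValuation V) {j k : ℕ} (hj : 1 ≤ j) (hjk : j ≤ k) :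
    marg V k ≤ marg V j := by
  induction k, hjk using Nat.le_induction with
  | base => exact le_rfl
  | succ k hk ih => exact (h.2.2.1 k (by omega)).trans ih

lemma exists_const (h : IsValuation V) : ∃ N, ∀ x, N ≤ x → V x = V N := by
  obtain ⟨N, hN⟩ := h.2.2.2
  refine ⟨N, fun x hx => ?_⟩
  induction x, hx using Nat.le_induction with
  | base => rfl
  | succ x hx ih =>
    have h1 := hN (x + 1) (by omega)
    simp only [marg, Nat.add_sub_cancel] at h1
    linarith

lemma zero : IsValuation (0 : ℕ → ℝ) :=
  ⟨rfl, fun _ _ _ => le_rfl, fun _ _ => by simp [marg], 0, fun _ _ => by simp [marg]⟩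

/-- Concavity along the ray from the origin. -/
lemma mul_le_mul_of_le (h : IsValuation V) {x y : ℕ} (hxy : x ≤ y) :
    (x : ℝ) * V y ≤ y * V x := by
  have key : ∀ x : ℕ, (x : ℝ) * marg V (x + 1) ≤ V x := by
    intro x
    induction x with
    | zero => simp [h.1]
    | succ x ih =>
      have h1 := h.2.2.1 (x + 1) (by omega)
      have h2 : V (x + 1) = V x + marg V (x + 1) := by simp [marg]
      push_cast
      have h3 : (0 : ℝ) ≤ x := Nat.cast_nonneg x
      nlinarith
  induction y, hxy using Nat.le_induction with
  | base => exact le_rfl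
  | succ y hy ih =>
    have h2 : V (y + 1) = V y + marg V (y + 1) := by simp [marg]
    rcases Nat.eq_zero_or_pos x with rfl | hx
    · simp [h.1]
    have h3 := h.marg_le_marg (j := x + 1) (k := y + 1) (by omega) (by omega)
    have h4 := key x
    have h5 : (x : ℝ) * marg V (y + 1) ≤ V x :=
      (mul_le_mul_of_nonneg_left h3 (Nat.cast_nonneg x)).trans h4
    push_cast
    rw [h2]
    nlinarith

end IsValuation

namespace IsCost

variable {Q : ℕ → ℝ}

lemma nonneg (h : IsCost Q) (x : ℕ) : 0 ≤ Q x := h.1 ▸ h.2.1 (Nat.zero_le x)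

lemma marg_le_marg (h : IsCost Q) {j k : ℕ} (hj : 1 ≤ j) (hjk : j ≤ k) :
    marg Q j ≤ marg Q k := by
  induction k, hjk using Nat.le_induction with
  | base => exact le_rfl
  | succ k hk ih =>
    refine ih.trans ?_
    simpa [marg] using h.2.2 k (by omega)

lemma add_le (h : IsCost Q) (x y : ℕ) : Q x + Q y ≤ Q (x + y) := by
  induction y with
  | zero => simp [h.1]
  | succ y ih =>
    have h1 := h.marg_le_marg (j := y + 1) (k := x + y + 1) (by omega) (by omega)
    simp only [marg, Nat.add_sub_cancel] at h1
    rw [← add_assoc]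
    linarith

lemma mul_le_mul_of_le (h : IsCost Q) {x y : ℕ} (hxy : x ≤ y) :
    (y : ℝ) * Q x ≤ x * Q y := by
  have key : ∀ x : ℕ, Q x ≤ (x : ℝ) * marg Q (x + 1) := by
    intro x
    induction x with
    | zero => simp [h.1]
    | succ x ih =>
      have h1 := h.marg_le_marg (j := x + 1) (k := x + 1 + 1) (by omega) (by omega)
      have h2 : Q (x + 1) = Q x + marg Q (x + 1) := by simp [marg]
      push_cast
      have h3 : (0 : ℝ) ≤ x := Nat.cast_nonneg x
      nlinarith
  induction y, hxy using Nat.le_induction with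
  | base => exact le_rfl
  | succ y hy ih =>
    have h2 : Q (y + 1) = Q y + marg Q (y + 1) := by simp [marg]
    have h3 := h.marg_le_marg (j := x + 1) (k := y + 1) (by omega) (by omega)
    have h4 := key x
    have h5 : Q x ≤ (x : ℝ) * marg Q (y + 1) :=
      h4.trans (mul_le_mul_of_nonneg_left h3 (Nat.cast_nonneg x))
    push_cast
    rw [h2]
    nlinarith

lemma le_mul_safeP (h : IsCost Q) {x K : ℕ} (hx : x ≤ K) : Q x ≤ x * safeP Q K := by
  rcases Nat.eq_zero_or_pos K with rfl | hK
  · have : x = 0 := by omega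
    subst this; simp [h.1]
  have hK' : (0 : ℝ) < K := Nat.cast_pos.2 hK
  rw [safeP, mul_div_assoc', le_div_iff₀ hK', mul_comm (Q x)]
  exact h.mul_le_mul_of_le hx

end IsCost

section Combined

variable {n : ℕ}

lemma finite_allocations (Vp : Fin n → ℕ → ℝ) (x : ℕ) :
    {s : ℝ | ∃ y : Fin n → ℕ, (∑ i, y i) = x ∧ s = ∑ i, Vp i (y i)}.Finite := by
  have hf : {y : Fin n → ℕ | ∀ i, y i ∈ Set.Iic x}.Finite := by
    have := Set.Finite.pi (fun _ : Fin n => Set.finite_Iic x)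
    refine this.subset fun y hy i _ => hy i
  refine (hf.image fun y => ∑ i, Vp i (y i)).subset ?_
  rintro s ⟨y, hy, rfl⟩
  refine ⟨y, fun i => ?_, rfl⟩
  rw [Set.mem_Iic, ← hy]
  exact Finset.single_le_sum (f := y) (fun _ _ => Nat.zero_le _) (Finset.mem_univ i)

lemma sum_le_comb (Vp : Fin n → ℕ → ℝ) (y : Fin n → ℕ) :
    ∑ i, Vp i (y i) ≤ comb Vp (∑ i, y i) :=
  le_csSup (finite_allocations Vp _).bddAbove ⟨y, rfl, rfl⟩

lemma exists_comb_eq [Nonempty (Fin n)] (Vp : Fin n → ℕ → ℝ) (x : ℕ) :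
    ∃ y : Fin n → ℕ, ∑ i, y i = x ∧ comb Vp x = ∑ i, Vp i (y i) := by
  have hne : {s : ℝ | ∃ y : Fin n → ℕ, (∑ i, y i) = x ∧ s = ∑ i, Vp i (y i)}.Nonempty :=
    ⟨_, Pi.single (Classical.arbitrary (Fin n)) x, by simp, rfl⟩
  exact hne.csSup_mem (finite_allocations Vp x)

lemma measurable_comb (x : ℕ) : Measurable fun Vp : Fin n → ℕ → ℝ => comb Vp x := by
  have : (fun Vp : Fin n → ℕ → ℝ => comb Vp x) =
      fun Vp => ⨆ y : {y : Fin n → ℕ // ∑ i, y i = x}, ∑ i, Vp i (y.1 i) := by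
    funext Vp
    rw [comb, iSup]
    congr 1
    ext s
    constructor
    · rintro ⟨y, hy, rfl⟩; exact ⟨⟨y, hy⟩, rfl⟩
    · rintro ⟨y, rfl⟩; exact ⟨y.1, y.2, rfl⟩
  rw [this]
  exact Measurable.iSup fun y => by fun_prop

lemma comb_mono [Nonempty (Fin n)] {Vp Wp : Fin n → ℕ → ℝ} (h : ∀ i x, Vp i x ≤ Wp i x)
    (x : ℕ) : comb Vp x ≤ comb Wp x := by
  obtain ⟨y, hy, he⟩ := exists_comb_eq Vp x
  rw [he, ← hy]
  exact (Finset.sum_le_sum fun i _ => h i _).trans (sum_le_comb Wp y)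

lemma isValuation_comb [Nonempty (Fin n)] {Vp : Fin n → ℕ → ℝ} (h : ∀ i, IsValuation (Vp i)) :
    IsValuation (comb Vp) := by
  have hmono : Monotone (comb Vp) := by
    refine monotone_nat_of_le_succ fun x => ?_
    obtain ⟨y, hy, he⟩ := exists_comb_eq Vp x
    have i₀ : Fin n := Classical.arbitrary _
    have hs : ∑ i, (y + Pi.single i₀ 1 : Fin n → ℕ) i = x + 1 := by
      simp [Finset.sum_add_distrib, hy]
    rw [he, ← hs]
    exact (Finset.sum_le_sum fun i _ => (h i).2.1 (by simp)).trans (sum_le_comb Vp _)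
  refine ⟨?_, hmono, fun x hx => ?_, ?_⟩
  · obtain ⟨y, hy, he⟩ := exists_comb_eq Vp 0
    rw [he]
    refine Finset.sum_eq_zero fun i hi => ?_
    rw [(Finset.sum_eq_zero_iff.1 hy) i hi, (h i).1]
  · obtain ⟨y, hy, hye⟩ := exists_comb_eq Vp (x + 1)
    obtain ⟨z, hz, hze⟩ := exists_comb_eq Vp (x - 1)
    obtain ⟨i, hi⟩ : ∃ i, z i < y i := by
      by_contra! hle
      have := Finset.sum_le_sum fun i (_ : i ∈ Finset.univ) => hle i
      omega
    have hyi := Finset.add_sum_erase Finset.univ y (Finset.mem_univ i)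
    have hzi := Finset.add_sum_erase Finset.univ z (Finset.mem_univ i)
    have hsum : ∀ (w : Fin n → ℕ) (k : ℕ), ∑ j, Function.update w i k j =
        k + ∑ j ∈ Finset.univ.erase i, w j := fun w k => by
      rw [← Finset.add_sum_erase _ _ (Finset.mem_univ i), Function.update_self]
      congr 1
      exact Finset.sum_congr rfl fun j hj => Function.update_of_ne (Finset.ne_of_mem_erase hj) _ _
    have hval : ∀ (w : Fin n → ℕ) (k : ℕ), ∑ j, Vp j (Function.update w i k j) =
        Vp i k + ∑ j ∈ Finset.univ.erase i, Vp j (w j) := fun w k => by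
      rw [← Finset.add_sum_erase _ _ (Finset.mem_univ i), Function.update_self]
      congr 1
      exact Finset.sum_congr rfl fun j hj => by
        rw [Function.update_of_ne (Finset.ne_of_mem_erase hj)]
    have hy' : ∑ j, Function.update y i (y i - 1) j = x := by rw [hsum]; omega
    have hz' : ∑ j, Function.update z i (z i + 1) j = x := by rw [hsum]; omega
    have h1 := sum_le_comb Vp (Function.update y i (y i - 1))
    have h2 := sum_le_comb Vp (Function.update z i (z i + 1))
    rw [hy', hval] at h1
    rw [hz', hval] at h2
    have h3 := (h i).marg_le_marg (j := z i + 1) (k := y i) (by omega) (by omega)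
    rw [← Finset.add_sum_erase _ _ (Finset.mem_univ i)] at hye hze
    simp only [marg, Nat.add_sub_cancel] at h3 ⊢
    linarith
  · choose N hN using fun i => (h i).exists_const
    refine ⟨∑ i, N i + 1, fun j hj => ?_⟩
    have hconst : ∀ x, comb Vp x ≤ comb Vp (∑ i, N i) := by
      intro x
      obtain ⟨y, -, hye⟩ := exists_comb_eq Vp x
      rw [hye]
      calc ∑ i, Vp i (y i) ≤ ∑ i, Vp i (N i) := Finset.sum_le_sum fun i _ => by
              rcases le_total (y i) (N i) with hle | hle
              · exact (h i).2.1 hle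
              · exact (hN i _ hle).le
        _ ≤ _ := sum_le_comb Vp N
    have h1 : ∀ x, ∑ i, N i ≤ x → comb Vp x = comb Vp (∑ i, N i) := fun x hx =>
      le_antisymm (hconst x) (hmono hx)
    rw [marg, h1 j (by omega), h1 (j - 1) (by omega), sub_self]

end Combined

section Sold

variable {V Q : ℕ → ℝ}

lemma le_sold_iff (h : IsValuation V) {K : ℕ} {P : ℝ} {j : ℕ} (hj : 1 ≤ j) :
    j ≤ sold (K : ℕ∞) P V ↔ j ≤ K ∧ P ≤ marg V j := by
  have hfin : min (K : ℕ∞) (dem V P) ≠ ⊤ :=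
    ne_top_of_le_ne_top (ENat.natCast_ne_top K) (min_le_left _ _)
  have hdem : (j : ℕ∞) ≤ dem V P ↔ P ≤ marg V j := by
    constructor
    · intro hle
      have hlt : ((j - 1 : ℕ) : ℕ∞) < dem V P :=
        lt_of_lt_of_le (by exact_mod_cast (by omega : j - 1 < j)) hle
      obtain ⟨a, ⟨k, rfl, hk1, hk⟩, hak⟩ := lt_sSup_iff.1 hlt
      have : j - 1 < k := by exact_mod_cast hak
      exact hk.trans (h.marg_le_marg hj (by omega))
    · exact fun hP => le_sSup ⟨j, rfl, hj, hP⟩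
  rw [sold, ← ENat.natCast_le_natCast, ENat.natCast_toNat hfin, le_min_iff, hdem, ENat.natCast_le_natCast]

lemma sold_le (K : ℕ) (P : ℝ) (V : ℕ → ℝ) : sold (K : ℕ∞) P V ≤ K := by
  rw [← ENat.natCast_le_natCast, sold, ENat.natCast_toNat
    (ne_top_of_le_ne_top (ENat.natCast_ne_top K) (min_le_left _ _))]
  exact min_le_left _ _

/-- The realized welfare of the safe-price auction with cap `K`, as a finite sum. -/
def safeGain (Q : ℕ → ℝ) (K : ℕ) (V : ℕ → ℝ) : ℝ :=
  ∑ j ∈ Finset.Icc 1 K, if safeP Q K ≤ marg V j then marg V j - marg Q j else 0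

lemma sum_marg (V : ℕ → ℝ) (m : ℕ) : ∑ j ∈ Finset.Icc 1 m, marg V j = V m - V 0 := by
  induction m with
  | zero => simp
  | succ m ih => rw [Finset.sum_Icc_succ_top (by omega), ih]; simp [marg]

lemma safeGain_eq (h : IsValuation V) (hQ : IsCost Q) (K : ℕ) :
    safeGain Q K V = V (sold (K : ℕ∞) (safeP Q K) V) - Q (sold (K : ℕ∞) (safeP Q K) V) := by
  set m := sold (K : ℕ∞) (safeP Q K) V with hm
  have h1 : V m - Q m = ∑ j ∈ Finset.Icc 1 m, (marg V j - marg Q j) := by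
    rw [Finset.sum_sub_distrib, sum_marg, sum_marg, h.1, hQ.1]; ring
  rw [h1, safeGain, ← Finset.sum_filter]
  refine Finset.sum_congr ?_ fun _ _ => rfl
  ext j
  simp only [Finset.mem_filter, Finset.mem_Icc]
  constructor
  · rintro ⟨⟨hj, hjK⟩, hP⟩; exact ⟨hj, (le_sold_iff h hj).2 ⟨hjK, hP⟩⟩
  · rintro ⟨hj, hjm⟩
    obtain ⟨h2, h3⟩ := (le_sold_iff h hj).1 hjm
    exact ⟨⟨hj, h2⟩, h3⟩

lemma sub_mul_safeP_le_safeGain (h : IsValuation V) (hQ : IsCost Q) {j K : ℕ} (hj : j ≤ K) :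
    V j - j * safeP Q K ≤ safeGain Q K V := by
  rw [safeGain_eq h hQ]
  set m := sold (K : ℕ∞) (safeP Q K) V with hm
  have hstep : ∀ x, V (x + 1) = V x + marg V (x + 1) := fun x => by simp [marg]
  have hmain : V j - j * safeP Q K ≤ V m - m * safeP Q K := by
    rcases le_total j m with hle | hle
    · have : ∀ b, j ≤ b → b ≤ m → V j - j * safeP Q K ≤ V b - b * safeP Q K := by
        intro b hb
        induction b, hb using Nat.le_induction with
        | base => exact fun _ => le_rfl
        | succ b hb ih =>
          intro hbm
          have h1 := ((le_sold_iff h (by omega)).1 hbm).2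
          have h2 := ih (by omega)
          rw [hstep]
          push_cast
          linarith
      exact this m hle le_rfl
    · have : ∀ b, m ≤ b → b ≤ K → V b - b * safeP Q K ≤ V m - m * safeP Q K := by
        intro b hb
        induction b, hb using Nat.le_induction with
        | base => exact fun _ => le_rfl
        | succ b hb ih =>
          intro hbK
          have h1 : marg V (b + 1) < safeP Q K := by
            by_contra! hP
            have := (le_sold_iff (j := b + 1) h (by omega)).2 ⟨hbK, hP⟩
            omega
          have h2 := ih (by omega)
          rw [hstep]
          push_cast
          linarith
      exact this j hle hj
  have := hQ.le_mul_safeP (sold_le K (safeP Q K) V)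
  linarith

lemma safeGain_nonneg (h : IsValuation V) (hQ : IsCost Q) (K : ℕ) : 0 ≤ safeGain Q K V := by
  have := sub_mul_safeP_le_safeGain h hQ (Nat.zero_le K)
  simpa [h.1] using this

lemma measurable_safeGain (Q : ℕ → ℝ) (K : ℕ) : Measurable (safeGain Q K) := by
  have hm : ∀ j, Measurable fun V : ℕ → ℝ => marg V j := fun j => by unfold marg; fun_prop
  exact Finset.measurable_fun_sum _ fun j _ => Measurable.ite
    (measurableSet_le measurable_const (hm j)) ((hm j).sub_const _) measurable_const

/-- The best welfare attainable for the valuation curve `V`. -/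
def optW (Q V : ℕ → ℝ) : ℝ := ⨆ x, (V x - Q x)

lemma exists_isMax (h : IsValuation V) (hQ : IsCost Q) :
    ∃ x, ∀ y, V y - Q y ≤ V x - Q x := by
  obtain ⟨N, hN⟩ := h.exists_const
  obtain ⟨x, -, hx⟩ := Finset.exists_max_image (Finset.range (N + 1)) (fun x => V x - Q x)
    ⟨0, by simp⟩
  refine ⟨x, fun y => ?_⟩
  rcases le_total y N with hle | hle
  · exact hx y (Finset.mem_range.2 (by omega))
  · refine le_trans ?_ (hx N (Finset.mem_range.2 (by omega)))
    have := hQ.2.1 hle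
    rw [hN y hle]; linarith

lemma bddAbove_welfare (h : IsValuation V) (hQ : IsCost Q) :
    BddAbove (Set.range fun x => V x - Q x) := by
  obtain ⟨x, hx⟩ := exists_isMax h hQ
  exact ⟨_, by rintro _ ⟨y, rfl⟩; exact hx y⟩

lemma le_optW (h : IsValuation V) (hQ : IsCost Q) (x : ℕ) : V x - Q x ≤ optW Q V :=
  le_ciSup (bddAbove_welfare h hQ) x

lemma exists_eq_optW (h : IsValuation V) (hQ : IsCost Q) : ∃ x, V x - Q x = optW Q V := by
  obtain ⟨x, hx⟩ := exists_isMax h hQ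
  exact ⟨x, le_antisymm (le_optW h hQ x) (ciSup_le hx)⟩

lemma safeGain_le_optW (h : IsValuation V) (hQ : IsCost Q) (K : ℕ) :
    safeGain Q K V ≤ optW Q V := by
  rw [safeGain_eq h hQ]; exact le_optW h hQ _

lemma optW_nonneg (h : IsValuation V) (hQ : IsCost Q) : 0 ≤ optW Q V := by
  simpa [h.1, hQ.1] using le_optW h hQ 0

/-- Of two curves, at least one does well under the cap that is optimal for the other one. -/
lemma min_optW_le_safeGain_add {V' : ℕ → ℝ} (h : IsValuation V) (h' : IsValuation V')
    (hQ : IsCost Q) {x x' : ℕ} (hx : V x - Q x = optW Q V) (hx' : V' x' - Q x' = optW Q V') :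
    min (optW Q V) (optW Q V') ≤ safeGain Q x' V + safeGain Q x V' := by
  wlog hle : x ≤ x' generalizing V V' x x'
  · rw [min_comm, add_comm]
    exact this h' h hx' hx (by omega)
  refine (min_le_left _ _).trans ?_
  have h1 := sub_mul_safeP_le_safeGain h hQ hle
  have h2 := sub_mul_safeP_le_safeGain h' hQ (le_refl x)
  rcases Nat.eq_zero_or_pos x with rfl | hx0
  · have := safeGain_nonneg h' hQ 0
    have := safeGain_nonneg h hQ x'
    have := h.1
    have := hQ.1
    linarith
  have hxp : (0 : ℝ) < x := Nat.cast_pos.2 hx0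
  have hxp' : (0 : ℝ) < x' := Nat.cast_pos.2 (by omega)
  have h3 : (x : ℝ) * safeP Q x = Q x := by rw [safeP]; field_simp
  have h4 : (x : ℝ) * safeP Q x' ≤ V' x := by
    rw [safeP, mul_div_assoc', div_le_iff₀ hxp']
    have h5 := h'.mul_le_mul_of_le hle
    have h6 := optW_nonneg h' hQ
    nlinarith
  linarith

end Sold


lemma measurePreserving_splice {ι E : Type*} [Fintype ι] [MeasurableSpace E]
    (F : ι → Measure E) [∀ i, IsProbabilityMeasure (F i)] (q : ι → Prop) [DecidablePred q] :
    MeasurePreserving (fun p : (ι → E) × (ι → E) => fun i => if q i then p.1 i else p.2 i)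
      ((Measure.pi F).prod (Measure.pi F)) (Measure.pi F) := by
  have hm : Measurable (fun p : (ι → E) × (ι → E) => fun i => if q i then p.1 i else p.2 i) := by
    refine measurable_pi_lambda _ fun i => ?_
    by_cases h : q i
    · simp only [h, if_true]; fun_prop
    · simp only [h, if_false]; fun_prop
  refine ⟨hm, (Measure.pi_eq fun s hs => ?_).symm⟩
  rw [Measure.map_apply hm (MeasurableSet.univ_pi hs)]
  have : (fun p : (ι → E) × (ι → E) => fun i => if q i then p.1 i else p.2 i) ⁻¹'
      (Set.univ.pi s) = (Set.univ.pi fun i => if q i then s i else Set.univ) ×ˢ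
        (Set.univ.pi fun i => if q i then Set.univ else s i) := by
    ext p
    simp only [Set.mem_preimage, Set.mem_pi, Set.mem_univ, true_imp_iff, Set.mem_prod]
    rw [← forall_and]
    refine forall_congr' fun i => ?_
    by_cases h : q i <;> simp [h]
  rw [this, Measure.prod_prod, Measure.pi_pi, Measure.pi_pi, ← Finset.prod_mul_distrib]
  refine Finset.prod_congr rfl fun i _ => ?_
  by_cases h : q i <;> simp [h]

/-- The indices `i` with `a ≤ i < b`. -/
def seg (n a b : ℕ) : Finset (Fin n) := Finset.univ.filter fun i => a ≤ i.val ∧ i.val < b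

/-- The largest value of a set function over the singletons contained in `S`. -/
def maxSingle {n : ℕ} {Ω : Type*} (Z : Finset (Fin n) → Ω → ℝ) (S : Finset (Fin n)) (ω : Ω) : ℝ :=
  ⨆ i : Fin n, Z (S ∩ {i}) ω

section

variable {n : ℕ} {Ω : Type*} {Z : Finset (Fin n) → Ω → ℝ}

lemma maxSingle_le [Nonempty (Fin n)] (hmono : ∀ S T ω, S ⊆ T → Z S ω ≤ Z T ω)
    (S : Finset (Fin n)) (ω : Ω) : maxSingle Z S ω ≤ Z S ω :=
  ciSup_le fun _ => hmono _ _ _ Finset.inter_subset_left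

lemma maxSingle_mono [Nonempty (Fin n)] (hmono : ∀ S T ω, S ⊆ T → Z S ω ≤ Z T ω)
    {S T : Finset (Fin n)} (h : S ⊆ T) (ω : Ω) : maxSingle Z S ω ≤ maxSingle Z T ω :=
  ciSup_mono (Set.finite_range _).bddAbove fun _ =>
    hmono _ _ _ (Finset.inter_subset_inter_right h)

lemma le_maxSingle {S : Finset (Fin n)} {i : Fin n} (hi : i ∈ S) (ω : Ω) :
    Z {i} ω ≤ maxSingle Z S ω := by
  have h := le_ciSup (f := fun i : Fin n => Z (S ∩ {i}) ω) (Set.finite_range _).bddAbove i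
  simp only [Finset.inter_singleton_of_mem hi] at h
  exact h

lemma maxSingle_nonneg [Nonempty (Fin n)] (hnn : ∀ S ω, 0 ≤ Z S ω)
    (S : Finset (Fin n)) (ω : Ω) : 0 ≤ maxSingle Z S ω :=
  Real.iSup_nonneg fun _ => hnn _ _

end

/-- The indicator that the running value started at `a` first reaches `τ` at index `j`. -/
def crossing {n : ℕ} {Ω : Type*} (Z : Finset (Fin n) → Ω → ℝ) (τ : ℝ) (a j : ℕ) (ω : Ω) : ℝ :=
  if Z (seg n a j) ω < τ ∧ τ ≤ Z (seg n a (j + 1)) ω then 1 else 0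

section

variable {n : ℕ} {Ω : Type*} {Z : Finset (Fin n) → Ω → ℝ} {τ : ℝ}

lemma crossing_nonneg (a j : ℕ) (ω : Ω) : 0 ≤ crossing Z τ a j ω := by
  unfold crossing; split_ifs <;> norm_num

lemma crossing_le_one (a j : ℕ) (ω : Ω) : crossing Z τ a j ω ≤ 1 := by
  unfold crossing; split_ifs <;> norm_num

lemma seg_mono (n : ℕ) {a a' b b' : ℕ} (ha : a' ≤ a) (hb : b ≤ b') : seg n a b ⊆ seg n a' b' := by
  intro i
  simp only [seg, Finset.mem_filter, Finset.mem_univ, true_and]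
  omega

lemma sum_crossing_le (hmono : ∀ S T ω, S ⊆ T → Z S ω ≤ Z T ω) {a : ℕ} (ha : a ≤ n) (ω : Ω) :
    ∑ j ∈ Finset.Ico a n, crossing Z τ a j ω ≤ if τ ≤ Z Finset.univ ω then 1 else 0 := by
  have key : ∀ b, a ≤ b → ∑ j ∈ Finset.Ico a b, crossing Z τ a j ω ≤
      if τ ≤ Z (seg n a b) ω then 1 else 0 := by
    intro b hb
    induction b, hb using Nat.le_induction with
    | base => simp only [Finset.Ico_self, Finset.sum_empty]; split_ifs <;> norm_num
    | succ b hb ih =>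
      rw [Finset.sum_Ico_succ_top hb]
      have hm := hmono _ _ ω (seg_mono n (le_refl a) (Nat.le_succ b))
      unfold crossing at ih ⊢
      rw [Nat.succ_eq_add_one] at hm
      split_ifs at ih ⊢ <;> grind
  refine (key n ha).trans ?_
  have := hmono _ _ ω (Finset.subset_univ (seg n a n))
  split_ifs <;> linarith

lemma sub_maxSingle_le_crossing [Nonempty (Fin n)] (h0 : ∀ ω, Z ∅ ω = 0)
    (hmono : ∀ S T ω, S ⊆ T → Z S ω ≤ Z T ω)
    (hsub : ∀ S T ω, Z (S ∪ T) ω ≤ Z S ω + Z T ω) (hτ : 0 < τ) (a : ℕ) (ω : Ω) :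
    Z (seg n a n) ω - maxSingle Z (seg n a n) ω ≤
      τ + ∑ j ∈ Finset.Ico a n, crossing Z τ a j ω *
        ((Z (seg n (j + 1) n) ω - maxSingle Z (seg n (j + 1) n) ω) +
          min (Z (seg n j (j + 1)) ω) (maxSingle Z (seg n (j + 1) n) ω)) := by
  have hnn : ∀ S ω, 0 ≤ Z S ω := fun S ω => (h0 ω) ▸ hmono _ _ ω (Finset.empty_subset S)
  have hterm : ∀ j ∈ Finset.Ico a n, 0 ≤ crossing Z τ a j ω *
        ((Z (seg n (j + 1) n) ω - maxSingle Z (seg n (j + 1) n) ω) +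
          min (Z (seg n j (j + 1)) ω) (maxSingle Z (seg n (j + 1) n) ω)) := fun j _ =>
    mul_nonneg (crossing_nonneg a j ω) (add_nonneg (sub_nonneg.2 (maxSingle_le hmono _ ω))
      (le_min (hnn _ _) (maxSingle_nonneg hnn _ ω)))
  by_cases hz : τ ≤ Z (seg n a n) ω
  · have hempty : seg n a a = ∅ := by
      ext i; simp only [seg, Finset.mem_filter, Finset.mem_univ, true_and, Finset.notMem_empty,
        iff_false]; omega
    classical
    have hex : ∃ b, τ ≤ Z (seg n a b) ω := ⟨n, hz⟩
    have hbn : Nat.find hex ≤ n := Nat.find_min' hex hz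
    have hab : a < Nat.find hex := by
      by_contra! hle
      have h1 := Nat.find_spec hex
      have h2 := hmono _ _ ω (seg_mono n (le_refl a) hle)
      rw [hempty, h0] at h2
      linarith
    obtain ⟨j, hj⟩ : ∃ j, Nat.find hex = j + 1 := ⟨Nat.find hex - 1, by omega⟩
    have hlt : Z (seg n a j) ω < τ := by
      have := Nat.find_min hex (m := j) (by omega)
      exact not_le.1 this
    have hge : τ ≤ Z (seg n a (j + 1)) ω := hj ▸ Nat.find_spec hex
    have hmem : j ∈ Finset.Ico a n := Finset.mem_Ico.2 ⟨by omega, by omega⟩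
    refine le_trans ?_ (add_le_add_right (Finset.single_le_sum hterm hmem) τ)
    have hc : crossing Z τ a j ω = 1 := if_pos ⟨hlt, hge⟩
    rw [hc, one_mul]
    have hun : seg n a n = (seg n a j ∪ seg n j (j + 1)) ∪ seg n (j + 1) n := by
      ext i
      simp only [seg, Finset.mem_filter, Finset.mem_univ, true_and, Finset.mem_union]
      have := i.2
      omega
    have hZ : Z (seg n a n) ω ≤ Z (seg n a j) ω + Z (seg n j (j + 1)) ω +
        Z (seg n (j + 1) n) ω := by
      rw [hun]
      exact (hsub _ _ ω).trans (add_le_add_left (hsub _ _ ω) _)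
    have hjn : j < n := by omega
    have hsing : seg n j (j + 1) = {⟨j, hjn⟩} := by
      ext i
      simp only [seg, Finset.mem_filter, Finset.mem_univ, true_and, Finset.mem_singleton, Fin.ext_iff]
      omega
    have hM1 : Z (seg n j (j + 1)) ω ≤ maxSingle Z (seg n a n) ω := by
      rw [hsing]
      refine le_maxSingle ?_ ω
      simp only [seg, Finset.mem_filter, Finset.mem_univ, true_and]
      omega
    have hM2 : maxSingle Z (seg n (j + 1) n) ω ≤ maxSingle Z (seg n a n) ω :=
      maxSingle_mono hmono (seg_mono n (by omega) le_rfl) ω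
    have hmm := min_add_max (Z (seg n j (j + 1)) ω) (maxSingle Z (seg n (j + 1) n) ω)
    have := max_le hM1 hM2
    linarith
  · have := Finset.sum_nonneg hterm
    have := maxSingle_nonneg hnn (seg n a n) ω
    linarith

end

/-- For independent coordinates, a monotone subadditive set function exceeds its largest
singleton by little, if the minimum of two independent copies is small in expectation. -/
theorem integral_le_integral_maxSingle_add {n : ℕ} [Nonempty (Fin n)] {E : Type*}
    [MeasurableSpace E] (F : Fin n → Measure E) [∀ i, IsProbabilityMeasure (F i)]
    (Z : Finset (Fin n) → (Fin n → E) → ℝ) (hmeas : ∀ S, Measurable (Z S))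
    (h0 : ∀ ω, Z ∅ ω = 0) (hmono : ∀ S T ω, S ⊆ T → Z S ω ≤ Z T ω)
    (hsub : ∀ S T ω, Z (S ∪ T) ω ≤ Z S ω + Z T ω)
    (hdep : ∀ S ω ω', (∀ i ∈ S, ω i = ω' i) → Z S ω = Z S ω')
    (hint : Integrable (Z Finset.univ) (Measure.pi F)) {A : ℝ} (hA : 0 < A)
    (hmin : ∫ r, min (Z Finset.univ r.1) (Z Finset.univ r.2)
      ∂((Measure.pi F).prod (Measure.pi F)) ≤ 2 * A) :
    ∫ ω, Z Finset.univ ω ∂(Measure.pi F) ≤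
      ∫ ω, maxSingle Z Finset.univ ω ∂(Measure.pi F) + 20 * A := by
  set μ := Measure.pi F with hμ
  set U : Finset (Fin n) := Finset.univ with hU
  have hnn : ∀ S ω, 0 ≤ Z S ω := fun S ω => (h0 ω) ▸ hmono _ _ ω (Finset.empty_subset S)
  have hleU : ∀ S ω, Z S ω ≤ Z U ω := fun S ω => hmono _ _ ω (Finset.subset_univ S)
  have hMmeas : ∀ S, Measurable (maxSingle Z S) := fun S => Measurable.iSup fun i => hmeas _
  have hMle : ∀ S ω, maxSingle Z S ω ≤ Z S ω := maxSingle_le hmono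
  have hMnn : ∀ S ω, 0 ≤ maxSingle Z S ω := maxSingle_nonneg hnn
  have hdom : ∀ g : (Fin n → E) → ℝ, Measurable g → (∀ ω, 0 ≤ g ω) → (∀ ω, g ω ≤ Z U ω) →
      Integrable g μ := fun g hg hg0 hg1 => hint.mono' hg.aestronglyMeasurable
    (Filter.Eventually.of_forall fun ω => by
      rw [Real.norm_of_nonneg (hg0 ω)]; exact hg1 ω)
  have hdom1 : ∀ g : (Fin n → E) → ℝ, Measurable g → (∀ ω, 0 ≤ g ω) → (∀ ω, g ω ≤ 1) →
      Integrable g μ := fun g hg hg0 hg1 =>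
    (integrable_const (1 : ℝ)).mono' hg.aestronglyMeasurable
    (Filter.Eventually.of_forall fun ω => by
      rw [Real.norm_of_nonneg (hg0 ω)]; exact hg1 ω)
  set τ := 8 * A with hτd
  have hτ : 0 < τ := by positivity
  have hint1 : Integrable (fun r : (Fin n → E) × (Fin n → E) => Z U r.1) (μ.prod μ) :=
    hint.comp_fst μ
  have hdom2 : ∀ g : (Fin n → E) × (Fin n → E) → ℝ, Measurable g → (∀ r, 0 ≤ g r) →
      (∀ r, g r ≤ Z U r.1) → Integrable g (μ.prod μ) := fun g hg hg0 hg1 =>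
    hint1.mono' hg.aestronglyMeasurable (Filter.Eventually.of_forall fun r => by
      rw [Real.norm_of_nonneg (hg0 r)]; exact hg1 r)
  have hminmeas : Measurable fun r : (Fin n → E) × (Fin n → E) => min (Z U r.1) (Z U r.2) :=
    ((hmeas U).comp measurable_fst).min ((hmeas U).comp measurable_snd)
  have hminint : Integrable (fun r : (Fin n → E) × (Fin n → E) => min (Z U r.1) (Z U r.2))
      (μ.prod μ) :=
    hdom2 _ hminmeas (fun r => le_min (hnn _ _) (hnn _ _)) fun r => min_le_left _ _
  -- the probability of reaching `τ`
  set u : (Fin n → E) → ℝ := fun ω => if τ ≤ Z U ω then 1 else 0 with hu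
  have humeas : Measurable u :=
    Measurable.ite (measurableSet_le measurable_const (hmeas U)) measurable_const measurable_const
  have hu0 : ∀ ω, 0 ≤ u ω := fun ω => by simp only [hu]; split_ifs <;> norm_num
  have hu1 : ∀ ω, u ω ≤ 1 := fun ω => by simp only [hu]; split_ifs <;> norm_num
  have huint : Integrable u μ := hdom1 u humeas hu0 hu1
  have hP : ∫ ω, u ω ∂μ ≤ 1 / 2 := by
    have h1 : ∫ r, τ * (u r.1 * u r.2) ∂(μ.prod μ) ≤ 2 * A := by
      refine le_trans (integral_mono ((huint.mul_prod huint).const_mul τ) hminint fun r => ?_) hmin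
      simp only [hu]
      have := hnn U r.1
      have := hnn U r.2
      split_ifs <;> simp <;> grind
    rw [integral_const_mul, integral_prod_mul] at h1
    by_contra! h3
    have h4 : 1 / 4 < (∫ ω, u ω ∂μ) * ∫ ω, u ω ∂μ := by nlinarith
    nlinarith
  have hcm : ∀ a j, Measurable (crossing Z τ a j) := fun a j =>
    Measurable.ite ((measurableSet_lt (hmeas _) measurable_const).inter
      (measurableSet_le measurable_const (hmeas _))) measurable_const measurable_const
  have hcint : ∀ a j, Integrable (crossing Z τ a j) μ := fun a j =>
    hdom1 _ (hcm a j) (crossing_nonneg a j) (crossing_le_one a j)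
  have hDint : ∀ S, Integrable (fun ω => Z S ω - maxSingle Z S ω) μ := fun S =>
    hdom _ ((hmeas S).sub (hMmeas S)) (fun ω => sub_nonneg.2 (hMle S ω)) fun ω => by
      have := hMnn S ω; have := hleU S ω; linarith
  have hcminm : ∀ a j, Measurable fun r : (Fin n → E) × (Fin n → E) =>
      crossing Z τ a j r.1 * min (Z U r.1) (Z U r.2) := fun a j =>
    ((hcm a j).comp measurable_fst).mul hminmeas
  have hcminint : ∀ a j, Integrable (fun r : (Fin n → E) × (Fin n → E) =>
      crossing Z τ a j r.1 * min (Z U r.1) (Z U r.2)) (μ.prod μ) := fun a j =>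
    hdom2 _ (hcminm a j)
      (fun r => mul_nonneg (crossing_nonneg _ _ _) (le_min (hnn _ _) (hnn _ _)))
      fun r => (mul_le_of_le_one_left (le_min (hnn _ _) (hnn _ _)) (crossing_le_one _ _ _)).trans
        (min_le_left _ _)
  have hterm : ∀ a j, a ≤ j → j < n →
      ∫ ω, crossing Z τ a j ω *
        ((Z (seg n (j + 1) n) ω - maxSingle Z (seg n (j + 1) n) ω) +
          min (Z (seg n j (j + 1)) ω) (maxSingle Z (seg n (j + 1) n) ω)) ∂μ ≤
      (∫ ω, crossing Z τ a j ω ∂μ) *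
          (∫ ω, (Z (seg n (j + 1) n) ω - maxSingle Z (seg n (j + 1) n) ω) ∂μ) +
        ∫ r, crossing Z τ a j r.1 * min (Z U r.1) (Z U r.2) ∂(μ.prod μ) := by
    intro a j haj hjn
    have hsp := measurePreserving_splice F (fun i : Fin n => i.val ≤ j)
    rw [← hμ] at hsp
    have hgm : Measurable fun ω => crossing Z τ a j ω *
        ((Z (seg n (j + 1) n) ω - maxSingle Z (seg n (j + 1) n) ω) +
          min (Z (seg n j (j + 1)) ω) (maxSingle Z (seg n (j + 1) n) ω)) :=
      (hcm a j).mul (((hmeas _).sub (hMmeas _)).add ((hmeas _).min (hMmeas _)))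
    rw [← hsp.map_eq, integral_map hsp.measurable.aemeasurable hgm.aestronglyMeasurable,
      hsp.map_eq, ← integral_prod_mul, ← integral_add ((hcint a j).mul_prod (hDint _))
        (hcminint a j)]
    have hpt : ∀ r : (Fin n → E) × (Fin n → E),
        (crossing Z τ a j (fun i => if i.val ≤ j then r.1 i else r.2 i) *
        ((Z (seg n (j + 1) n) (fun i => if i.val ≤ j then r.1 i else r.2 i) -
            maxSingle Z (seg n (j + 1) n) (fun i => if i.val ≤ j then r.1 i else r.2 i)) +
          min (Z (seg n j (j + 1)) (fun i => if i.val ≤ j then r.1 i else r.2 i))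
            (maxSingle Z (seg n (j + 1) n) (fun i => if i.val ≤ j then r.1 i else r.2 i)))) =
        crossing Z τ a j r.1 * ((Z (seg n (j + 1) n) r.2 - maxSingle Z (seg n (j + 1) n) r.2) +
          min (Z (seg n j (j + 1)) r.1) (maxSingle Z (seg n (j + 1) n) r.2)) := by
      intro r
      have hlow : ∀ S : Finset (Fin n), (∀ i ∈ S, i.val ≤ j) →
          Z S (fun i => if i.val ≤ j then r.1 i else r.2 i) = Z S r.1 := fun S hS =>
        hdep S _ _ fun i hi => if_pos (hS i hi)
      have hhigh : ∀ S : Finset (Fin n), (∀ i ∈ S, j + 1 ≤ i.val) →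
          Z S (fun i => if i.val ≤ j then r.1 i else r.2 i) = Z S r.2 := fun S hS =>
        hdep S _ _ fun i hi => if_neg (by have := hS i hi; omega)
      have hMhigh : maxSingle Z (seg n (j + 1) n) (fun i => if i.val ≤ j then r.1 i else r.2 i) =
          maxSingle Z (seg n (j + 1) n) r.2 := by
        unfold maxSingle
        congr 1; funext i
        refine hhigh _ fun k hk => ?_
        have := Finset.mem_of_mem_inter_left hk
        simp only [seg, Finset.mem_filter] at this; omega
      have hseg : ∀ b c, ∀ i ∈ seg n b c, b ≤ i.val ∧ i.val < c := fun b c i hi => by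
        simpa [seg] using hi
      have hc : crossing Z τ a j (fun i => if i.val ≤ j then r.1 i else r.2 i) =
          crossing Z τ a j r.1 := by
        unfold crossing
        rw [hlow _ fun i hi => by have := hseg _ _ i hi; omega,
          hlow _ fun i hi => by have := hseg _ _ i hi; omega]
      rw [hc, hMhigh, hhigh _ fun i hi => by have := hseg _ _ i hi; omega,
        hlow _ fun i hi => by have := hseg _ _ i hi; omega]
    simp only [hpt]
    refine integral_mono_of_nonneg (Filter.Eventually.of_forall fun r => ?_)
      (((hcint a j).mul_prod (hDint _)).add (hcminint a j))
      (Filter.Eventually.of_forall fun r => ?_)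
    · exact mul_nonneg (crossing_nonneg _ _ _) (add_nonneg (sub_nonneg.2 (hMle _ _))
        (le_min (hnn _ _) (hMnn _ _)))
    · simp only
      rw [mul_add]
      exact add_le_add_right (mul_le_mul_of_nonneg_left (min_le_min (hleU _ _)
        ((hMle _ _).trans (hleU _ _))) (crossing_nonneg _ _ _)) _
  have hrec : ∀ k a, n - a = k → a ≤ n →
      ∫ ω, (Z (seg n a n) ω - maxSingle Z (seg n a n) ω) ∂μ ≤ 20 * A := by
    intro k
    induction k using Nat.strong_induction_on with
    | _ k ih =>
    intro a hk ha
    have htint : ∀ j ∈ Finset.Ico a n, Integrable (fun ω => crossing Z τ a j ω *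
        ((Z (seg n (j + 1) n) ω - maxSingle Z (seg n (j + 1) n) ω) +
          min (Z (seg n j (j + 1)) ω) (maxSingle Z (seg n (j + 1) n) ω))) μ := by
      intro j _
      have hb0 : ∀ ω, 0 ≤ (Z (seg n (j + 1) n) ω - maxSingle Z (seg n (j + 1) n) ω) +
          min (Z (seg n j (j + 1)) ω) (maxSingle Z (seg n (j + 1) n) ω) := fun ω =>
        add_nonneg (sub_nonneg.2 (hMle _ ω)) (le_min (hnn _ _) (hMnn _ ω))
      refine hdom _ ((hcm a j).mul (((hmeas _).sub (hMmeas _)).add ((hmeas _).min (hMmeas _))))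
        (fun ω => mul_nonneg (crossing_nonneg a j ω) (hb0 ω)) fun ω => ?_
      refine (mul_le_of_le_one_left (hb0 ω) (crossing_le_one _ _ _)).trans ?_
      have := min_le_right (Z (seg n j (j + 1)) ω) (maxSingle Z (seg n (j + 1) n) ω)
      have := hleU (seg n (j + 1) n) ω
      linarith
    have hI : ∫ ω, (Z (seg n a n) ω - maxSingle Z (seg n a n) ω) ∂μ ≤
        ∫ ω, (τ + ∑ j ∈ Finset.Ico a n, crossing Z τ a j ω *
        ((Z (seg n (j + 1) n) ω - maxSingle Z (seg n (j + 1) n) ω) +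
          min (Z (seg n j (j + 1)) ω) (maxSingle Z (seg n (j + 1) n) ω))) ∂μ :=
      integral_mono (hDint _) ((integrable_const τ).add (integrable_finsetSum _ htint))
        fun ω => sub_maxSingle_le_crossing h0 hmono hsub hτ a ω
    rw [integral_add (integrable_const τ) (integrable_finsetSum _ htint),
      integral_finsetSum _ htint, integral_const, probReal_univ, one_smul] at hI
    have hsum : ∑ j ∈ Finset.Ico a n, ∫ ω, crossing Z τ a j ω *
        ((Z (seg n (j + 1) n) ω - maxSingle Z (seg n (j + 1) n) ω) +
          min (Z (seg n j (j + 1)) ω) (maxSingle Z (seg n (j + 1) n) ω)) ∂μ ≤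
        ∑ j ∈ Finset.Ico a n, ((∫ ω, crossing Z τ a j ω ∂μ) * (20 * A) +
          ∫ r, crossing Z τ a j r.1 * min (Z U r.1) (Z U r.2) ∂(μ.prod μ)) := by
      refine Finset.sum_le_sum fun j hj => ?_
      rw [Finset.mem_Ico] at hj
      refine (hterm a j hj.1 hj.2).trans (add_le_add_left ?_ _)
      exact mul_le_mul_of_nonneg_left (ih (n - (j + 1)) (by omega) (j + 1) rfl (by omega))
        (integral_nonneg (crossing_nonneg a j))
    rw [Finset.sum_add_distrib, ← Finset.sum_mul, ← integral_finsetSum _ fun j _ => hcint a j,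
      ← integral_finsetSum _ fun j _ => hcminint a j] at hsum
    have hs1 : ∫ ω, ∑ j ∈ Finset.Ico a n, crossing Z τ a j ω ∂μ ≤ 1 / 2 :=
      (integral_mono (integrable_finsetSum _ fun j _ => hcint a j) huint
        fun ω => sum_crossing_le hmono ha ω).trans hP
    have hs2 : ∫ r, ∑ j ∈ Finset.Ico a n, crossing Z τ a j r.1 * min (Z U r.1) (Z U r.2)
        ∂(μ.prod μ) ≤ 2 * A := by
      refine (integral_mono (integrable_finsetSum _ fun j _ => hcminint a j) hminint
        fun r => ?_).trans hmin
      simp only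
      rw [← Finset.sum_mul]
      exact mul_le_of_le_one_left (le_min (hnn _ _) (hnn _ _))
        ((sum_crossing_le hmono ha r.1).trans (hu1 r.1))
    nlinarith
  have hfin := hrec n 0 (by omega) (by omega)
  have hU' : seg n 0 n = U := by ext i; simp [seg, hU]
  rw [hU', integral_sub hint (hdom _ (hMmeas U) (hMnn U) (hMle U))] at hfin
  linarith

section Truncation

lemma measurableSet_isValuation : MeasurableSet {V : ℕ → ℝ | IsValuation V} := by
  have hm : ∀ j, Measurable fun V : ℕ → ℝ => marg V j := fun j => by unfold marg; fun_prop
  have h1 : MeasurableSet {V : ℕ → ℝ | V 0 = 0} :=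
    measurableSet_eq_fun (measurable_pi_apply 0) measurable_const
  have h2 : MeasurableSet {V : ℕ → ℝ | Monotone V} := by
    have : {V : ℕ → ℝ | Monotone V} = ⋂ j, {V : ℕ → ℝ | V j ≤ V (j + 1)} := by
      ext V
      simp only [Set.mem_ofPred_eq, Set.mem_iInter]
      exact ⟨fun h j => h (Nat.le_succ j), monotone_nat_of_le_succ⟩
    rw [this]
    exact MeasurableSet.iInter fun j =>
      measurableSet_le (measurable_pi_apply j) (measurable_pi_apply (j + 1))
  have h3 : MeasurableSet {V : ℕ → ℝ | ∀ j : ℕ, 1 ≤ j → marg V (j + 1) ≤ marg V j} := by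
    have : {V : ℕ → ℝ | ∀ j : ℕ, 1 ≤ j → marg V (j + 1) ≤ marg V j} =
        ⋂ j : ℕ, ⋂ _ : 1 ≤ j, {V : ℕ → ℝ | marg V (j + 1) ≤ marg V j} := by ext V; simp
    rw [this]
    exact MeasurableSet.iInter fun j => MeasurableSet.iInter fun _ => measurableSet_le (hm _) (hm _)
  have h4 : MeasurableSet {V : ℕ → ℝ | ∃ N : ℕ, ∀ j : ℕ, N ≤ j → marg V j = 0} := by
    have : {V : ℕ → ℝ | ∃ N : ℕ, ∀ j : ℕ, N ≤ j → marg V j = 0} =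
        ⋃ N : ℕ, ⋂ j : ℕ, ⋂ _ : N ≤ j, {V : ℕ → ℝ | marg V j = 0} := by ext V; simp
    rw [this]
    exact MeasurableSet.iUnion fun N => MeasurableSet.iInter fun j => MeasurableSet.iInter fun _ =>
      measurableSet_eq_fun (hm _) measurable_const
  exact h1.inter (h2.inter (h3.inter h4))

open Classical in
/-- Replace a curve that is not a valuation by the zero curve. -/
def toValuation (V : ℕ → ℝ) : ℕ → ℝ := if IsValuation V then V else 0

lemma isValuation_toValuation (V : ℕ → ℝ) : IsValuation (toValuation V) := by
  unfold toValuation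
  split_ifs with h
  · exact h
  · exact IsValuation.zero

lemma measurable_toValuation : Measurable toValuation :=
  Measurable.ite measurableSet_isValuation measurable_id measurable_const

variable {n : ℕ}

/-- The profile in which the firms outside `S` have been removed. -/
def restrictTo (S : Finset (Fin n)) (ω : Fin n → ℕ → ℝ) : Fin n → ℕ → ℝ :=
  fun i => if i ∈ S then toValuation (ω i) else 0

lemma isValuation_restrictTo (S : Finset (Fin n)) (ω : Fin n → ℕ → ℝ) (i : Fin n) :
    IsValuation (restrictTo S ω i) := by
  unfold restrictTo
  split_ifs
  · exact isValuation_toValuation _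
  · exact IsValuation.zero

lemma measurable_restrictTo (S : Finset (Fin n)) :
    Measurable (restrictTo S : (Fin n → ℕ → ℝ) → Fin n → ℕ → ℝ) := by
  refine measurable_pi_lambda _ fun i => ?_
  unfold restrictTo
  split_ifs
  · exact measurable_toValuation.comp (measurable_pi_apply i)
  · exact measurable_const

/-- The combined valuation curve of the firms in `S`. -/
def combOn (S : Finset (Fin n)) (ω : Fin n → ℕ → ℝ) : ℕ → ℝ := comb (restrictTo S ω)

lemma isValuation_combOn [Nonempty (Fin n)] (S : Finset (Fin n)) (ω : Fin n → ℕ → ℝ) :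
    IsValuation (combOn S ω) :=
  isValuation_comb (isValuation_restrictTo S ω)

lemma measurable_combOn (S : Finset (Fin n)) :
    Measurable (combOn S : (Fin n → ℕ → ℝ) → ℕ → ℝ) :=
  measurable_pi_lambda _ fun x => (measurable_comb x).comp (measurable_restrictTo S)

variable {Q : ℕ → ℝ}

lemma measurable_optW_combOn (Q : ℕ → ℝ) (S : Finset (Fin n)) :
    Measurable fun ω : Fin n → ℕ → ℝ => optW Q (combOn S ω) :=
  Measurable.iSup fun x => ((measurable_pi_apply x).comp (measurable_combOn S)).sub_const _

lemma optW_combOn_mono [Nonempty (Fin n)] (hQ : IsCost Q) {S T : Finset (Fin n)} (hST : S ⊆ T)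
    (ω : Fin n → ℕ → ℝ) : optW Q (combOn S ω) ≤ optW Q (combOn T ω) := by
  refine ciSup_le fun x => le_trans (sub_le_sub_right ?_ _)
    (le_optW (isValuation_combOn T ω) hQ x)
  refine comb_mono (fun i x => ?_) x
  unfold restrictTo
  by_cases hS : i ∈ S
  · rw [if_pos hS, if_pos (hST hS)]
  · rw [if_neg hS]
    exact (isValuation_restrictTo T ω i).nonneg x

lemma optW_combOn_union_le [Nonempty (Fin n)] (hQ : IsCost Q) (S T : Finset (Fin n))
    (ω : Fin n → ℕ → ℝ) :
    optW Q (combOn (S ∪ T) ω) ≤ optW Q (combOn S ω) + optW Q (combOn T ω) := by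
  refine ciSup_le fun x => ?_
  obtain ⟨y, hy, hye⟩ := exists_comb_eq (restrictTo (S ∪ T) ω) x
  have h1 := sum_le_comb (restrictTo S ω) fun i => if i ∈ S then y i else 0
  have h2 := sum_le_comb (restrictTo T ω) fun i => if i ∈ S then 0 else y i
  have hsum : ∑ i, restrictTo (S ∪ T) ω i (y i) ≤
      ∑ i, restrictTo S ω i (if i ∈ S then y i else 0) +
        ∑ i, restrictTo T ω i (if i ∈ S then 0 else y i) := by
    rw [← Finset.sum_add_distrib]
    refine Finset.sum_le_sum fun i _ => ?_
    have hS := (isValuation_restrictTo S ω i).1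
    have hT := (isValuation_restrictTo T ω i).1
    by_cases hiS : i ∈ S
    · simp only [hiS, if_true, hT]
      simp [restrictTo, hiS]
    · simp only [hiS, if_false, hS]
      simp [restrictTo, hiS]
  have hxs : x = (∑ i, if i ∈ S then y i else 0) + ∑ i, if i ∈ S then 0 else y i := by
    rw [← Finset.sum_add_distrib, ← hy]
    exact Finset.sum_congr rfl fun i _ => by split_ifs <;> simp
  have h3 := le_optW (isValuation_combOn S ω) hQ (∑ i, if i ∈ S then y i else 0)
  have h4 := le_optW (isValuation_combOn T ω) hQ (∑ i, if i ∈ S then 0 else y i)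
  have h5 := hQ.add_le (∑ i, if i ∈ S then y i else 0) (∑ i, if i ∈ S then 0 else y i)
  rw [← hxs] at h5
  unfold combOn at h3 h4 ⊢
  linarith

lemma optW_combOn_empty [Nonempty (Fin n)] (hQ : IsCost Q) (ω : Fin n → ℕ → ℝ) :
    optW Q (combOn ∅ ω) = 0 := by
  refine le_antisymm (ciSup_le fun x => ?_) (optW_nonneg (isValuation_combOn ∅ ω) hQ)
  obtain ⟨y, -, hye⟩ := exists_comb_eq (restrictTo ∅ ω) x
  have h0 : comb (restrictTo ∅ ω) x = 0 := by
    rw [hye]; exact Finset.sum_eq_zero fun i _ => by simp [restrictTo]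
  have := hQ.nonneg x
  rw [combOn, h0]; linarith

lemma optW_combOn_singleton_le [Nonempty (Fin n)] (hQ : IsCost Q) (i : Fin n)
    (ω : Fin n → ℕ → ℝ) : optW Q (combOn {i} ω) ≤ optW Q (toValuation (ω i)) := by
  refine ciSup_le fun x => le_trans (sub_le_sub_right ?_ _)
    (le_optW (isValuation_toValuation (ω i)) hQ x)
  obtain ⟨y, hy, hye⟩ := exists_comb_eq (restrictTo {i} ω) x
  rw [combOn, hye, Finset.sum_eq_single i]
  · rw [restrictTo, if_pos (Finset.mem_singleton_self i)]
    refine (isValuation_toValuation (ω i)).2.1 ?_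
    rw [← hy]
    exact Finset.single_le_sum (f := y) (fun _ _ => Nat.zero_le _) (Finset.mem_univ i)
  · intro j _ hj
    simp [restrictTo, hj]
  · simp

lemma optW_combOn_le_sum [Nonempty (Fin n)] (hQ : IsCost Q) (S : Finset (Fin n))
    (ω : Fin n → ℕ → ℝ) :
    optW Q (combOn S ω) ≤ ∑ i ∈ S, optW Q (toValuation (ω i)) := by
  induction S using Finset.induction_on with
  | empty => rw [optW_combOn_empty hQ]; simp
  | insert i S hi ih =>
    rw [Finset.sum_insert hi, Finset.insert_eq]
    exact (optW_combOn_union_le hQ _ _ ω).trans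
      (add_le_add (optW_combOn_singleton_le hQ i ω) ih)

lemma optW_le_sSup {ω : Fin n → ℕ → ℝ} (hω : ∀ i, IsValuation (ω i)) (hQ : IsCost Q) (i : Fin n) :
    optW Q (ω i) ≤ sSup {w : ℝ | ∃ (i : Fin n) (x : ℕ), w = ω i x - Q x} := by
  refine ciSup_le fun x => le_csSup ⟨∑ i, optW Q (ω i), ?_⟩ ⟨i, x, rfl⟩
  rintro w ⟨j, y, rfl⟩
  exact (le_optW (hω j) hQ y).trans
    (Finset.single_le_sum (f := fun i => optW Q (ω i)) (fun i _ => optW_nonneg (hω i) hQ)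
      (Finset.mem_univ j))

lemma restrictTo_univ {ω : Fin n → ℕ → ℝ} (hω : ∀ i, IsValuation (ω i)) :
    restrictTo Finset.univ ω = ω := by
  funext i
  simp [restrictTo, toValuation, hω i]

end Truncation

/-- If some `g K` is large at one of any two points, for an index `K` selected at the other one,
then the minimum of two independent copies of `Y` is at most `2 * A` in expectation. -/
lemma integral_min_le_of_selection {Ω : Type*} [MeasurableSpace Ω] (μ : Measure Ω)
    [IsProbabilityMeasure μ] {Y : Ω → ℝ} (hYint : Integrable Y μ)
    {g : ℕ → Ω → ℝ} (hg : ∀ K, Measurable (g K)) (hg0 : ∀ K ω, 0 ≤ g K ω)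
    (hgY : ∀ K ω, g K ω ≤ Y ω) {A : ℝ} (hA : ∀ K, ∫ ω, g K ω ∂μ ≤ A) {x : Ω → ℕ}
    (hx : Measurable x) (hmin : ∀ ω ω', min (Y ω) (Y ω') ≤ g (x ω') ω + g (x ω) ω') :
    ∫ r, min (Y r.1) (Y r.2) ∂(μ.prod μ) ≤ 2 * A := by
  have hgm : Measurable fun r : Ω × ℕ => g r.2 r.1 :=
    measurable_from_prod_countable_left fun K => hg K
  have hm1 : Measurable fun r : Ω × Ω => g (x r.2) r.1 :=
    hgm.comp (measurable_fst.prodMk (hx.comp measurable_snd))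
  have hm2 : Measurable fun r : Ω × Ω => g (x r.1) r.2 :=
    hgm.comp (measurable_snd.prodMk (hx.comp measurable_fst))
  have hi1 : Integrable (fun r : Ω × Ω => g (x r.2) r.1) (μ.prod μ) :=
    (hYint.comp_fst μ).mono' hm1.aestronglyMeasurable (Filter.Eventually.of_forall fun r => by
      rw [Real.norm_of_nonneg (hg0 _ _)]; exact hgY _ _)
  have hi2 : Integrable (fun r : Ω × Ω => g (x r.1) r.2) (μ.prod μ) :=
    (hYint.comp_snd μ).mono' hm2.aestronglyMeasurable (Filter.Eventually.of_forall fun r => by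
      rw [Real.norm_of_nonneg (hg0 _ _)]; exact hgY _ _)
  have hY0 : ∀ ω, 0 ≤ Y ω := fun ω => (hg0 0 ω).trans (hgY 0 ω)
  have hle : ∀ h : Ω → ℝ, (∀ ω, 0 ≤ h ω) → (∀ ω, h ω ≤ A) → ∫ ω, h ω ∂μ ≤ A := by
    intro h hh0 hhA
    refine (integral_mono_of_nonneg (Filter.Eventually.of_forall hh0) (integrable_const A)
      (Filter.Eventually.of_forall hhA)).trans ?_
    simp
  calc ∫ r, min (Y r.1) (Y r.2) ∂(μ.prod μ)
      ≤ ∫ r, (g (x r.2) r.1 + g (x r.1) r.2) ∂(μ.prod μ) :=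
        integral_mono_of_nonneg (Filter.Eventually.of_forall fun r => le_min (hY0 _) (hY0 _))
          (hi1.add hi2) (Filter.Eventually.of_forall fun r => hmin r.1 r.2)
    _ = ∫ ω', ∫ ω, g (x ω') ω ∂μ ∂μ + ∫ ω, ∫ ω', g (x ω) ω' ∂μ ∂μ := by
        rw [integral_add hi1 hi2, integral_prod_symm _ hi1, integral_prod _ hi2]
    _ ≤ A + A := add_le_add
        (hle _ (fun ω => integral_nonneg (hg0 _)) fun ω => hA _)
        (hle _ (fun ω => integral_nonneg (hg0 _)) fun ω => hA _)
    _ = 2 * A := by ring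

/-- If `(C,p)` is welfare-optimal among no-ceiling cap-and-price
auctions, then there is a cap with `26·W(M(cap)) + W^{(1)} ≥ W(M(C,p))`, and hence
the same bound holds against every cap and price floor. -/
theorem stmt2 {n : ℕ} (hn : 1 ≤ n) (F : Fin n → Measure (ℕ → ℝ))
    (hprob : ∀ i, IsProbabilityMeasure (F i))
    (hval : ∀ i, F i {V | IsValuation V} = 1)
    (hint : ∀ (i : Fin n) (x : ℕ), Integrable (fun V : ℕ → ℝ => V x) (F i))
    (Q : ℕ → ℝ) (hQ : IsCost Q)
    (hW1int : Integrable
      (fun Vp : Fin n → ℕ → ℝ => sSup {w : ℝ | ∃ (i : Fin n) (x : ℕ), w = Vp i x - Q x})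
      (piProb F))
    (C : ℕ) (p : ℝ) (hC : 1 ≤ C) (hp : 0 ≤ p)
    (hopt : ∀ (C' : ℕ) (p' : ℝ), 1 ≤ C' → 0 ≤ p' →
      Wcomb F Q (C' : ℕ∞) p' ≤ Wcomb F Q (C : ℕ∞) p) :
    ∃ C2 : ℕ, 1 ≤ C2 ∧
      Wcomb F Q (C : ℕ∞) p ≤ 26 * Wcomb F Q (C2 : ℕ∞) (safeP Q C2) + W1 F Q ∧
      ∀ (C3 : ℕ) (p3 : ℝ), 1 ≤ C3 → 0 ≤ p3 →
        Wcomb F Q (C3 : ℕ∞) p3 ≤ 26 * Wcomb F Q (C2 : ℕ∞) (safeP Q C2) + W1 F Q := by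


  have : Nonempty (Fin n) := ⟨⟨0, hn⟩⟩
  suffices hmain : ∃ C2 : ℕ, 1 ≤ C2 ∧
      Wcomb F Q (C : ℕ∞) p ≤ 26 * Wcomb F Q (C2 : ℕ∞) (safeP Q C2) + W1 F Q by
    obtain ⟨C2, hC2, h⟩ := hmain
    exact ⟨C2, hC2, h, fun C3 p3 h3 hp3 => (hopt C3 p3 h3 hp3).trans h⟩
  have hpi : piProb F = Measure.pi F := by rw [piProb, dif_pos hprob]
  rw [hpi] at hW1int
  set μ := Measure.pi F with hμ
  have hgood : ∀ᵐ ω ∂μ, ∀ i, IsValuation (ω i) := by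
    refine Filter.eventually_all.2 fun i => ?_
    have h1 : ∀ᵐ V ∂(F i), IsValuation V :=
      (mem_ae_iff_prob_eq_one measurableSet_isValuation).2 (hval i)
    exact Measure.tendsto_eval_ae_ae.eventually h1
  set Z : Finset (Fin n) → (Fin n → ℕ → ℝ) → ℝ := fun S ω => optW Q (combOn S ω) with hZ
  set U : Finset (Fin n) := Finset.univ with hU
  have hZm : ∀ S, Measurable (Z S) := measurable_optW_combOn Q
  have hZnn : ∀ S ω, 0 ≤ Z S ω := fun S ω => optW_nonneg (isValuation_combOn S ω) hQ
  have hsan : ∀ {ω : Fin n → ℕ → ℝ}, (∀ i, IsValuation (ω i)) → ∀ i, toValuation (ω i) = ω i :=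
    fun hω i => if_pos (hω i)
  have hZint : Integrable (Z U) μ := by
    refine (hW1int.const_mul (n : ℝ)).mono' (hZm U).aestronglyMeasurable ?_
    filter_upwards [hgood] with ω hω
    rw [Real.norm_of_nonneg (hZnn U ω)]
    refine (optW_combOn_le_sum hQ U ω).trans ?_
    refine (Finset.sum_le_card_nsmul U _ (sSup {w : ℝ | ∃ (i : Fin n) (x : ℕ), w = ω i x - Q x})
      fun i _ => ?_).trans_eq ?_
    · rw [hsan hω]; exact optW_le_sSup hω hQ i
    · simp [hU]
  have hW1 : ∫ ω, maxSingle Z U ω ∂μ ≤ W1 F Q := by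
    rw [W1, hpi]
    refine integral_mono_of_nonneg (Filter.Eventually.of_forall (maxSingle_nonneg hZnn U))
      hW1int ?_
    filter_upwards [hgood] with ω hω
    refine ciSup_le fun i => ?_
    rw [hU, Finset.univ_inter]
    refine (optW_combOn_singleton_le hQ i ω).trans ?_
    rw [hsan hω]; exact optW_le_sSup hω hQ i
  have hWle : Wcomb F Q (C : ℕ∞) p ≤ ∫ ω, Z U ω ∂μ := by
    rw [Wcomb, hpi]
    by_cases hi : Integrable (fun Vp : Fin n → ℕ → ℝ =>
        comb Vp (sold C p (comb Vp)) - Q (sold C p (comb Vp))) μ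
    · refine integral_mono_ae hi hZint ?_
      filter_upwards [hgood] with ω hω
      have := le_optW (isValuation_combOn U ω) hQ (sold C p (comb ω))
      rw [combOn, hU, restrictTo_univ hω] at this
      simpa only [hZ, combOn, hU, restrictTo_univ hω] using this
    · rw [integral_undef hi]
      exact integral_nonneg (hZnn U)
  have hsafe : ∀ K : ℕ, Wcomb F Q (K : ℕ∞) (safeP Q K) =
      ∫ ω, safeGain Q K (combOn U ω) ∂μ := by
    intro K
    rw [Wcomb, hpi]
    refine integral_congr_ae ?_
    filter_upwards [hgood] with ω hω
    rw [safeGain_eq (isValuation_combOn U ω) hQ, combOn, hU, restrictTo_univ hω]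
  have hgnn : ∀ K ω, 0 ≤ safeGain Q K (combOn U ω) := fun K ω =>
    safeGain_nonneg (isValuation_combOn U ω) hQ K
  by_contra! hcon
  obtain ⟨A, hA⟩ : ∃ A, 26 * A = Wcomb F Q (C : ℕ∞) p - W1 F Q :=
    ⟨(Wcomb F Q (C : ℕ∞) p - W1 F Q) / 26, by ring⟩
  have hlt : ∀ K : ℕ, 1 ≤ K → ∫ ω, safeGain Q K (combOn U ω) ∂μ < A := fun K hK => by
    have := hcon K hK
    rw [hsafe] at this
    linarith
  have hApos : 0 < A := (integral_nonneg (hgnn 1)).trans_lt (hlt 1 le_rfl)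
  have hAle : ∀ K : ℕ, ∫ ω, safeGain Q K (combOn U ω) ∂μ ≤ A := by
    intro K
    rcases Nat.eq_zero_or_pos K with rfl | hK
    · simp [safeGain, hApos.le]
    · exact (hlt K hK).le
  classical
  have hex : ∀ ω : Fin n → ℕ → ℝ, ∃ x, combOn U ω x - Q x = Z U ω := fun ω =>
    exists_eq_optW (isValuation_combOn U ω) hQ
  have hxm : Measurable fun ω => Nat.find (hex ω) := measurable_find hex fun k =>
    measurableSet_eq_fun (((measurable_pi_apply k).comp (measurable_combOn U)).sub_const _) (hZm U)
  have hmin := integral_min_le_of_selection μ hZint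
    (g := fun K ω => safeGain Q K (combOn U ω))
    (fun K => (measurable_safeGain Q K).comp (measurable_combOn U)) hgnn
    (fun K ω => safeGain_le_optW (isValuation_combOn U ω) hQ K) hAle hxm
    fun ω ω' => min_optW_le_safeGain_add (isValuation_combOn U ω) (isValuation_combOn U ω') hQ
      (Nat.find_spec (hex ω)) (Nat.find_spec (hex ω'))
  have hfin := integral_le_integral_maxSingle_add F Z hZm (fun ω => optW_combOn_empty hQ ω)
    (fun S T ω h => optW_combOn_mono hQ h ω) (fun S T ω => optW_combOn_union_le hQ S T ω)
    (fun S ω ω' h => by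
      have : restrictTo S ω = restrictTo S ω' := by
        funext i
        unfold restrictTo
        split_ifs with hi
        · rw [h i hi]
        · rfl
      simp only [hZ, combOn, this])
    hZint hApos hmin
  linarith

end
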